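/- arXiv:1504.01612 — 4 statements merged into one kernel-verified Lean document; each statement's English description precedes it below -/
import Mathlib

section
/- Fix α ∈ (0,1), γ ∈ (0,1) and ν > 0, ν ≠ 1, and set x_n = ⌊αn⌋. Then the weighted Rényi entropy H_ν^{φ}(f_{n,x_n}) = (1−ν)^{−1}·log ∫₀¹ φ_n(p)·( f_{n,x_n}(p) )^ν dp satisfies lim_{n→∞} [ H_ν^{φ}(f_{n,x_n}) − (1/2)·log( 2π·α(1−α)/n ) ] = − log(ν)/( 2(1−ν) ) + (α−γ)²/( 2α(1−α)·ν ). -/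
open MeasureTheory Real Filter

/-- The Beta(x+1, n-x+1) posterior density `f_{n,x}` on `[0,1]`, extended by `0` outside. -/
noncomputable def betaDensity (n x : ℕ) (p : ℝ) : ℝ :=
  if 0 ≤ p ∧ p ≤ 1 then ((n : ℝ) + 1) * (n.choose x : ℝ) * p ^ x * (1 - p) ^ (n - x) else 0

/-- The normalizing constant `Λ_n(γ)` of the weight function. -/
noncomputable def weightLambda (n x : ℕ) (γ : ℝ) : ℝ :=
  Real.Gamma ((x : ℝ) + 1) * Real.Gamma ((n : ℝ) - (x : ℝ) + 1) *
    Real.Gamma ((n : ℝ) + 2 + Real.sqrt n) /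
  (Real.Gamma ((x : ℝ) + γ * Real.sqrt n + 1) *
    Real.Gamma ((n : ℝ) - (x : ℝ) + 1 + (1 - γ) * Real.sqrt n) *
    Real.Gamma ((n : ℝ) + 2))

/-- The weight function `φ_n(p) = Λ_n(γ) p^{γ√n} (1-p)^{(1-γ)√n}`. -/
noncomputable def weightPhi (n x : ℕ) (γ : ℝ) (p : ℝ) : ℝ :=
  weightLambda n x γ * p ^ (γ * Real.sqrt n) * (1 - p) ^ ((1 - γ) * Real.sqrt n)

/-- Weighted Rényi entropy of order `ν`: `H_ν^φ(f) = (1-ν)⁻¹ log ∫₀¹ φ f^ν`. -/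
noncomputable def weightedRenyiEntropy (ν : ℝ) (n x : ℕ) (γ : ℝ) : ℝ :=
  (1 - ν)⁻¹ * Real.log (∫ p in Set.Ioo (0 : ℝ) 1, weightPhi n x γ p * betaDensity n x p ^ ν)


/-- Logarithmic form of Stirling's formula for factorials. -/
lemma tendsto_log_factorial_sub_stirling :
    Tendsto (fun n : ℕ => log (n.factorial : ℝ) -
      ((n : ℝ) * log n - n + 1 / 2 * log n + 1 / 2 * log (2 * π))) atTop (nhds 0) := by
  have h := (Stirling.tendsto_stirlingSeq_sqrt_pi.log (by positivity)).sub_const (log √π)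
  rw [sub_self] at h
  refine h.congr' ?_
  filter_upwards [eventually_gt_atTop 0] with n hn
  have hn' : (n : ℝ) ≠ 0 := by positivity
  rw [Stirling.log_stirlingSeq_formula, log_div hn' (exp_ne_zero _), log_exp,
    log_sqrt pi_pos.le, log_mul two_ne_zero hn', log_mul two_ne_zero pi_ne_zero]
  ring

lemma abs_one_add_mul_log_one_add_sub_le {t : ℝ} (ht : |t| ≤ 1 / 2) :
    |(1 + t) * log (1 + t) - t - t ^ 2 / 2| ≤ 4 * |t| ^ 3 := by
  have h := abs_log_sub_add_sum_range_le (x := -t) (by rw [abs_neg]; linarith) 2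
  norm_num [Finset.sum_range_succ] at h
  have h2 : |t| ^ 3 / (1 - |t|) ≤ 2 * |t| ^ 3 := by
    rw [div_le_iff₀ (by linarith)]
    nlinarith [pow_nonneg (abs_nonneg t) 3]
  set e := -t + t ^ 2 / 2 + log (1 + t) with he
  have h3 : |e| ≤ 2 * |t| ^ 3 := h.trans h2
  have h4 : (1 + t) * log (1 + t) - t - t ^ 2 / 2 = -(t ^ 3 / 2) + (1 + t) * e := by
    rw [he]; ring
  have h5 : |1 + t| ≤ 3 / 2 := by
    rw [abs_le] at ht ⊢; constructor <;> linarith [ht.1, ht.2]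
  rw [h4]
  calc _ ≤ |-(t ^ 3 / 2)| + |(1 + t) * e| := abs_add_le _ _
    _ = |t| ^ 3 / 2 + |1 + t| * |e| := by
      rw [abs_neg, abs_div, abs_pow, abs_mul]; norm_num
    _ ≤ |t| ^ 3 / 2 + 3 / 2 * (2 * |t| ^ 3) := by gcongr
    _ ≤ _ := by nlinarith [pow_nonneg (abs_nonneg t) 3]

section Perturbation

variable {ι : Type*} {l : Filter ι} {A u : ι → ℝ} {L : ℝ}

lemma tendsto_div_zero_of_sq_div (hA : Tendsto A l atTop)
    (hu : Tendsto (fun i => u i ^ 2 / A i) l (nhds L)) :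
    Tendsto (fun i => u i / A i) l (nhds 0) := by
  have h : Tendsto (fun i => (u i / A i) ^ 2) l (nhds 0) := by
    have := hu.mul hA.inv_tendsto_atTop
    rw [mul_zero] at this
    refine this.congr fun i => ?_
    simp only [Pi.inv_apply, div_eq_mul_inv]; ring
  have h2 := h.sqrt
  simp only [sqrt_sq_eq_abs, sqrt_zero] at h2
  exact (tendsto_zero_iff_abs_tendsto_zero _).2 h2

lemma tendsto_log_add_sub_log (hA : Tendsto A l atTop)
    (hu : Tendsto (fun i => u i / A i) l (nhds 0)) :
    Tendsto (fun i => log (A i + u i) - log (A i)) l (nhds 0) := by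
  have h : Tendsto (fun i => log (1 + u i / A i)) l (nhds 0) := by
    have := (hu.const_add 1).log (by norm_num)
    simpa using this
  refine h.congr' ?_
  filter_upwards [hA.eventually_gt_atTop 0, hu.eventually (lt_mem_nhds (a := -1) (by norm_num))]
    with i hi hui
  have h1 : A i + u i = A i * (1 + u i / A i) := by field_simp
  rw [h1, log_mul hi.ne' (by linarith)]
  ring

/-- Second-order expansion of `z log z` around a large base point. -/
lemma tendsto_mul_log_add_sub (hA : Tendsto A l atTop)
    (hu : Tendsto (fun i => u i ^ 2 / A i) l (nhds L)) :
    Tendsto (fun i => (A i + u i) * log (A i + u i) - A i * log (A i) - u i * log (A i) - u i) l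
      (nhds (L / 2)) := by
  have ht := tendsto_div_zero_of_sq_div hA hu
  have hr : Tendsto (fun i => A i * ((1 + u i / A i) * log (1 + u i / A i) - u i / A i
      - (u i / A i) ^ 2 / 2)) l (nhds 0) := by
    have hb : Tendsto (fun i => 4 * ((u i ^ 2 / A i) * |u i / A i|)) l (nhds 0) := by
      have := (hu.mul ht.abs).const_mul 4
      simpa using this
    refine squeeze_zero_norm' ?_ hb
    have hs : ∀ᶠ i in l, |u i / A i| ≤ 1 / 2 :=
      ht.abs.eventually (ge_mem_nhds (by norm_num))
    filter_upwards [hA.eventually_gt_atTop 0, hs] with i hi hti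
    rw [norm_mul, Real.norm_of_nonneg hi.le, Real.norm_eq_abs]
    refine (mul_le_mul_of_nonneg_left (abs_one_add_mul_log_one_add_sub_le hti) hi.le).trans
      (le_of_eq ?_)
    have h3 : |u i / A i| ^ 3 = (u i / A i) ^ 2 * |u i / A i| := by
      rw [pow_succ, sq_abs]
    rw [h3]; field_simp
  have := hr.add (hu.div_const 2)
  rw [zero_add] at this
  refine this.congr' ?_
  filter_upwards [hA.eventually_gt_atTop 0, ht.eventually (lt_mem_nhds (a := -1) (by norm_num))]
    with i hi hui
  have h1 : A i + u i = A i * (1 + u i / A i) := by field_simp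
  rw [h1, log_mul hi.ne' (by linarith)]
  field_simp
  ring

lemma tendsto_add_atTop_of_div_zero (hA : Tendsto A l atTop)
    (hu : Tendsto (fun i => u i / A i) l (nhds 0)) :
    Tendsto (fun i => A i + u i) l atTop := by
  have h := hA.atTop_mul_pos (C := 1) one_pos (by simpa using hu.const_add 1)
  refine h.congr' ?_
  filter_upwards [hA.eventually_gt_atTop 0] with i hi
  field_simp

end Perturbation

lemma log_factorial_add_mul_log_le_log_Gamma {n : ℕ} (hn : n ≠ 0) {θ : ℝ} (hθ : 0 ≤ θ) :
    log (n.factorial : ℝ) + θ * log n ≤ log (Gamma (n + θ + 1)) := by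
  rcases hθ.eq_or_lt with rfl | hθ
  · simp [Gamma_nat_eq_factorial]
  have h := BohrMollerup.f_add_nat_ge (n := n + 1) convexOn_log_Gamma
    (fun {y} hy => by
      simp only [Function.comp_apply]
      rw [Gamma_add_one hy.ne', log_mul hy.ne' (Gamma_pos_of_pos hy).ne']; ring)
    (by lia) hθ
  simp only [Function.comp_apply, Nat.cast_add, Nat.cast_one, Gamma_nat_eq_factorial,
    add_sub_cancel_right] at h
  rwa [add_right_comm] at h

lemma log_Gamma_le_log_factorial_add_mul_log (n : ℕ) {θ : ℝ} (hθ : 0 ≤ θ) (hθ' : θ ≤ 1) :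
    log (Gamma (n + θ + 1)) ≤ log (n.factorial : ℝ) + θ * log (n + 1) := by
  rcases hθ.eq_or_lt with rfl | hθ
  · simp [Gamma_nat_eq_factorial]
  have h := BohrMollerup.f_add_nat_le (n := n + 1) convexOn_log_Gamma
    (fun {y} hy => by
      simp only [Function.comp_apply]
      rw [Gamma_add_one hy.ne', log_mul hy.ne' (Gamma_pos_of_pos hy).ne']; ring)
    (by lia) hθ hθ'
  simp only [Function.comp_apply, Nat.cast_add, Nat.cast_one, Gamma_nat_eq_factorial] at h
  rwa [add_right_comm] at h

/-- Logarithmic form of Stirling's formula for the real Gamma function. -/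
lemma tendsto_log_Gamma_sub_stirling :
    Tendsto (fun z : ℝ => log (Gamma (z + 1)) -
      (z * log z - z + 1 / 2 * log z + 1 / 2 * log (2 * π))) atTop (nhds 0) := by
  have hfl : Tendsto (fun z : ℝ => ⌊z⌋₊) atTop atTop := tendsto_nat_floor_atTop
  have hA : Tendsto (fun z : ℝ => (⌊z⌋₊ : ℝ)) atTop atTop :=
    tendsto_natCast_atTop_atTop.comp hfl
  have hfr : ∀ᶠ z : ℝ in atTop, 0 ≤ z - ⌊z⌋₊ ∧ z - ⌊z⌋₊ ≤ 1 := by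
    filter_upwards [eventually_ge_atTop 0] with z hz
    exact ⟨sub_nonneg.2 (Nat.floor_le hz), by linarith [Nat.lt_floor_add_one z]⟩
  have hu : Tendsto (fun z : ℝ => (z - ⌊z⌋₊) ^ 2 / (⌊z⌋₊ : ℝ)) atTop (nhds 0) := by
    refine squeeze_zero' (Eventually.of_forall fun z => by positivity) ?_ hA.inv_tendsto_atTop
    filter_upwards [hfr] with z hz
    rw [Pi.inv_apply, ← one_div]
    gcongr
    exact pow_le_one₀ hz.1 hz.2
  have ht := tendsto_div_zero_of_sq_div hA hu
  have hlog := tendsto_log_add_sub_log hA ht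
  have hmul := tendsto_mul_log_add_sub hA hu
  have hlog1 := tendsto_log_add_sub_log (u := fun _ => 1) hA
    (by simpa using! hA.inv_tendsto_atTop)
  have hgam : Tendsto (fun z : ℝ => log (Gamma (z + 1)) -
      (log ((⌊z⌋₊).factorial : ℝ) + (z - ⌊z⌋₊) * log (⌊z⌋₊ : ℝ))) atTop (nhds 0) := by
    refine squeeze_zero' ?_ ?_ hlog1
    · filter_upwards [hfr, hfl.eventually_ne_atTop 0] with z hz h0
      have := log_factorial_add_mul_log_le_log_Gamma h0 hz.1
      rw [add_sub_cancel] at this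
      linarith
    · filter_upwards [hfr, hfl.eventually_ne_atTop 0] with z hz h0
      have := log_Gamma_le_log_factorial_add_mul_log ⌊z⌋₊ hz.1 hz.2
      rw [add_sub_cancel] at this
      have h1 : log (⌊z⌋₊ : ℝ) ≤ log ((⌊z⌋₊ : ℝ) + 1) := by
        apply log_le_log (by positivity); linarith
      nlinarith [hz.2]
  have hst := tendsto_log_factorial_sub_stirling.comp hfl
  have := ((hgam.add hst).sub hmul).sub (hlog.const_mul (1 / 2))
  norm_num only at this
  refine this.congr fun z => ?_
  simp only [Function.comp_apply, add_sub_cancel]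
  ring

/-- Stirling's formula for `Γ(A + u + 1)` expanded around `A`, for a perturbation `u` of order
`√A`. -/
lemma tendsto_log_Gamma_add_sub {ι : Type*} {l : Filter ι} {A u : ι → ℝ} {L : ℝ}
    (hA : Tendsto A l atTop) (hu : Tendsto (fun i => u i ^ 2 / A i) l (nhds L)) :
    Tendsto (fun i => log (Gamma (A i + u i + 1)) - (A i * log (A i) - A i + u i * log (A i)
      + 1 / 2 * log (A i) + 1 / 2 * log (2 * π))) l (nhds (L / 2)) := by
  have ht := tendsto_div_zero_of_sq_div hA hu
  have h1 := tendsto_log_Gamma_sub_stirling.comp (tendsto_add_atTop_of_div_zero hA ht)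
  have := (h1.add (tendsto_mul_log_add_sub hA hu)).add
    ((tendsto_log_add_sub_log hA ht).const_mul (1 / 2))
  rw [zero_add, mul_zero, add_zero] at this
  refine this.congr fun i => ?_
  simp only [Function.comp_apply]
  ring

lemma integral_Ioo_rpow_mul_one_sub_rpow {a b : ℝ} (ha : 0 < a) (hb : 0 < b) :
    ∫ p in Set.Ioo (0 : ℝ) 1, p ^ (a - 1) * (1 - p) ^ (b - 1) = ProbabilityTheory.beta a b := by
  rw [ProbabilityTheory.beta_eq_betaIntegralReal a b ha hb, Complex.betaIntegral,
    intervalIntegral.integral_of_le zero_le_one, ← integral_Ioc_eq_integral_Ioo]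
  have key : ∫ p in Set.Ioc (0 : ℝ) 1, (p : ℂ) ^ ((a : ℂ) - 1) * (1 - (p : ℂ)) ^ ((b : ℂ) - 1)
      = ((∫ p in Set.Ioc (0 : ℝ) 1, p ^ (a - 1) * (1 - p) ^ (b - 1) : ℝ) : ℂ) := by
    rw [← integral_complex_ofReal]
    refine setIntegral_congr_fun measurableSet_Ioc fun p hp => ?_
    have h1 : (0 : ℝ) ≤ 1 - p := by linarith [hp.2]
    simp only [Complex.ofReal_mul]
    rw [Complex.ofReal_cpow hp.1.le, Complex.ofReal_cpow h1]
    push_cast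
    rfl
  rw [key, Complex.ofReal_re]

lemma succ_mul_choose_eq_Gamma_div {n x : ℕ} (hx : x ≤ n) :
    ((n : ℝ) + 1) * (n.choose x : ℝ) =
      Gamma ((n : ℝ) + 1 + 1) / (Gamma ((x : ℝ) + 1) * Gamma ((n : ℝ) - x + 1)) := by
  have hn : (n : ℝ) + 1 ≠ 0 := by positivity
  rw [Gamma_add_one hn, Gamma_nat_eq_factorial, Gamma_nat_eq_factorial, ← Nat.cast_sub hx,
    Gamma_nat_eq_factorial, Nat.cast_choose ℝ hx]
  ring

lemma setIntegral_weightPhi_mul_betaDensity_rpow {n x : ℕ} (hx : x ≤ n) {γ ν : ℝ}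
    (hγ : γ ∈ Set.Ioo (0 : ℝ) 1) (hν : 0 < ν) :
    ∫ p in Set.Ioo (0 : ℝ) 1, weightPhi n x γ p * betaDensity n x p ^ ν =
      weightLambda n x γ * (((n : ℝ) + 1) * (n.choose x : ℝ)) ^ ν *
        ProbabilityTheory.beta (ν * x + γ * √n + 1) (ν * (n - x) + (1 - γ) * √n + 1) := by
  have hx' : (0 : ℝ) ≤ n - x := sub_nonneg.2 (Nat.cast_le.2 hx)
  have h1 : 0 ≤ γ * √n := mul_nonneg hγ.1.le (sqrt_nonneg _)
  have h2 : 0 ≤ (1 - γ) * √n := mul_nonneg (sub_pos.2 hγ.2).le (sqrt_nonneg _)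
  rw [← integral_Ioo_rpow_mul_one_sub_rpow (by positivity) (by positivity),
    ← integral_const_mul]
  refine setIntegral_congr_fun measurableSet_Ioo fun p hp => ?_
  have hq : 0 < 1 - p := sub_pos.2 hp.2
  have hp0 : 0 < p := hp.1
  simp only [weightPhi, betaDensity, if_pos (And.intro hp.1.le hp.2.le), add_sub_cancel_right]
  rw [mul_rpow (by positivity) (by positivity), mul_rpow (by positivity) (by positivity),
    rpow_add hp0, rpow_add hq, mul_comm ν, mul_comm ν, rpow_mul hp0.le (x : ℝ),
    rpow_mul hq.le ((n : ℝ) - x),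
    rpow_natCast, ← Nat.cast_sub hx, rpow_natCast]
  ring

lemma log_setIntegral_weightPhi_mul_betaDensity_rpow {n x : ℕ} (hx : x ≤ n) {γ ν : ℝ}
    (hγ : γ ∈ Set.Ioo (0 : ℝ) 1) (hν : 0 < ν) :
    log (∫ p in Set.Ioo (0 : ℝ) 1, weightPhi n x γ p * betaDensity n x p ^ ν) =
      (1 - ν) * (log (Gamma (x + 0 + 1)) + log (Gamma ((n - x) + 0 + 1))
          - log (Gamma (n + 1 + 1)))
        - (log (Gamma (x + γ * √n + 1)) + log (Gamma ((n - x) + (1 - γ) * √n + 1))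
          - log (Gamma (n + (√n + 1) + 1)))
        + (log (Gamma (ν * x + γ * √n + 1)) + log (Gamma (ν * (n - x) + (1 - γ) * √n + 1))
          - log (Gamma (ν * n + (√n + 1) + 1))) := by
  have hx' : (0 : ℝ) ≤ n - x := sub_nonneg.2 (Nat.cast_le.2 hx)
  have h1 : 0 ≤ γ * √n := mul_nonneg hγ.1.le (sqrt_nonneg _)
  have h2 : 0 ≤ (1 - γ) * √n := mul_nonneg (sub_pos.2 hγ.2).le (sqrt_nonneg _)
  have hΛ : weightLambda n x γ = Gamma ((x : ℝ) + 1) * Gamma ((n : ℝ) - x + 1) *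
      Gamma ((n : ℝ) + (√n + 1) + 1) / (Gamma (x + γ * √n + 1) *
        Gamma ((n - x) + (1 - γ) * √n + 1) * Gamma ((n : ℝ) + 1 + 1)) := by
    rw [weightLambda, show (n : ℝ) + (√n + 1) + 1 = n + 2 + √n by ring,
      show (n : ℝ) + 1 + 1 = n + 2 by ring, add_right_comm ((n : ℝ) - x)]
  have hβ : ν * x + γ * √n + 1 + (ν * (n - x) + (1 - γ) * √n + 1) = ν * n + (√n + 1) + 1 := by
    ring
  rw [setIntegral_weightPhi_mul_betaDensity_rpow hx hγ hν, succ_mul_choose_eq_Gamma_div hx, hΛ,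
    ProbabilityTheory.beta, hβ, add_zero, add_zero]
  have g1 : 0 < Gamma ((x : ℝ) + 1) := Gamma_pos_of_pos (by positivity)
  have g2 : 0 < Gamma ((n : ℝ) - x + 1) := Gamma_pos_of_pos (by positivity)
  have g3 : 0 < Gamma ((n : ℝ) + 1 + 1) := Gamma_pos_of_pos (by positivity)
  have g4 : 0 < Gamma (x + γ * √n + 1) := Gamma_pos_of_pos (by positivity)
  have g5 : 0 < Gamma ((n - x) + (1 - γ) * √n + 1) := Gamma_pos_of_pos (by positivity)
  have g6 : 0 < Gamma (n + (√n + 1) + 1) := Gamma_pos_of_pos (by positivity)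
  have g7 : 0 < Gamma (ν * x + γ * √n + 1) := Gamma_pos_of_pos (by positivity)
  have g8 : 0 < Gamma (ν * (n - x) + (1 - γ) * √n + 1) := Gamma_pos_of_pos (by positivity)
  have g9 : 0 < Gamma (ν * n + (√n + 1) + 1) := Gamma_pos_of_pos (by positivity)
  simp (disch := positivity) only [log_mul, log_div, log_rpow]
  ring

lemma tendsto_sqrt_perturbation_sq_div {A : ℕ → ℝ} {a : ℝ} (ha : 0 < a)
    (hA : Tendsto (fun n => A n / n) atTop (nhds a)) (c d : ℝ) :
    Tendsto (fun n : ℕ => (c * √n + d) ^ 2 / A n) atTop (nhds (c ^ 2 / a)) := by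
  have hs : Tendsto (fun n : ℕ => (√(n : ℝ))⁻¹) atTop (nhds 0) :=
    (tendsto_sqrt_atTop.comp tendsto_natCast_atTop_atTop).inv_tendsto_atTop
  have h := (((hs.const_mul d).const_add c).pow 2).div hA ha.ne'
  rw [mul_zero, add_zero] at h
  refine h.congr' ?_
  filter_upwards [eventually_gt_atTop 0] with n hn
  have hn' : (0 : ℝ) < n := Nat.cast_pos.2 hn
  have hs0 : 0 < √(n : ℝ) := sqrt_pos.2 hn'
  have h1 : c + d * (√(n : ℝ))⁻¹ = (c * √n + d) / √n := by field_simp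
  rw [Pi.div_apply, h1, div_pow, sq_sqrt hn'.le, div_div_div_cancel_right₀ hn'.ne']

lemma tendsto_atTop_of_div_natCast {A : ℕ → ℝ} {a : ℝ} (ha : 0 < a)
    (hA : Tendsto (fun n => A n / n) atTop (nhds a)) : Tendsto A atTop atTop := by
  refine ((tendsto_natCast_atTop_atTop (R := ℝ)).atTop_mul_pos ha hA).congr' ?_
  filter_upwards [eventually_gt_atTop 0] with n hn
  have hn' : (n : ℝ) ≠ 0 := by positivity
  field_simp

lemma tendsto_log_sub_log_natCast {A : ℕ → ℝ} {a : ℝ} (ha : 0 < a)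
    (hA : Tendsto (fun n => A n / n) atTop (nhds a)) :
    Tendsto (fun n : ℕ => log (A n) - log n) atTop (nhds (log a)) := by
  refine (hA.log ha.ne').congr' ?_
  filter_upwards [eventually_gt_atTop 0, (tendsto_atTop_of_div_natCast ha hA).eventually_gt_atTop 0]
    with n hn hAn
  rw [log_div hAn.ne' (by positivity)]

/-- `tendsto_log_Gamma_add_sub` for a base point of linear growth and a perturbation of order
`√n`. -/
lemma tendsto_log_Gamma_sqrt_perturbation {A u : ℕ → ℝ} {a c d : ℝ} (ha : 0 < a)
    (hA : Tendsto (fun n => A n / n) atTop (nhds a)) (hu : ∀ n : ℕ, u n = c * √n + d) :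
    Tendsto (fun n => log (Gamma (A n + u n + 1)) - (A n * log (A n) - A n + u n * log (A n)
      + 1 / 2 * log (A n) + 1 / 2 * log (2 * π))) atTop (nhds (c ^ 2 / a / 2)) :=
  tendsto_log_Gamma_add_sub (tendsto_atTop_of_div_natCast ha hA)
    ((tendsto_sqrt_perturbation_sq_div ha hA c d).congr fun n => by rw [hu])

/-- For `α, γ ∈ (0,1)`, `ν > 0`, `ν ≠ 1` and `x_n = ⌊αn⌋`, the weighted Rényi
entropy satisfies
`H_ν^φ(f_{n,x_n}) - (1/2) log(2π α(1-α)/n) → - log ν/(2(1-ν)) + (α-γ)²/(2α(1-α)ν)`. -/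
theorem weighted_renyi_entropy_asymptotics
    (α γ ν : ℝ) (hα : α ∈ Set.Ioo (0 : ℝ) 1) (hγ : γ ∈ Set.Ioo (0 : ℝ) 1)
    (hν : 0 < ν) (hν1 : ν ≠ 1) :
    Tendsto (fun n : ℕ =>
        weightedRenyiEntropy ν n (Nat.floor (α * n)) γ -
          (1 / 2) * Real.log (2 * Real.pi * α * (1 - α) / n)) atTop
      (nhds (-Real.log ν / (2 * (1 - ν)) + (α - γ) ^ 2 / (2 * α * (1 - α) * ν))) := by
  obtain ⟨hα0, hα1⟩ := hα
  have hα1' : 0 < 1 - α := sub_pos.2 hα1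
  have hν1' : 1 - ν ≠ 0 := sub_ne_zero.2 hν1.symm
  have hx : Tendsto (fun n : ℕ => (⌊α * n⌋₊ : ℝ) / n) atTop (nhds α) :=
    (tendsto_nat_floor_mul_div_atTop hα0.le).comp tendsto_natCast_atTop_atTop
  have hn : Tendsto (fun n : ℕ => (n : ℝ) / n) atTop (nhds 1) := by
    refine tendsto_const_nhds.congr' ?_
    filter_upwards [eventually_gt_atTop 0] with n hn
    rw [div_self (by positivity)]
  have hy : Tendsto (fun n : ℕ => ((n : ℝ) - ⌊α * n⌋₊) / n) atTop (nhds (1 - α)) :=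
    (hn.sub hx).congr fun n => by rw [sub_div]
  have scale : ∀ {A : ℕ → ℝ} {a : ℝ}, Tendsto (fun n => A n / n) atTop (nhds a) →
      Tendsto (fun n => ν * A n / n) atTop (nhds (ν * a)) := fun h =>
    (h.const_mul ν).congr fun n => by rw [mul_div_assoc]
  have e1 := tendsto_log_Gamma_sqrt_perturbation (u := fun _ => 0) (c := 0) (d := 0) hα0 hx
    (by simp)
  have e2 := tendsto_log_Gamma_sqrt_perturbation (u := fun _ => 0) (c := 0) (d := 0) hα1' hy
    (by simp)
  have e3 := tendsto_log_Gamma_sqrt_perturbation (u := fun _ => 1) (c := 0) (d := 1) one_pos hn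
    (by simp)
  have e4 := tendsto_log_Gamma_sqrt_perturbation (u := fun n => γ * √n) (c := γ) (d := 0) hα0 hx
    (by simp)
  have e5 := tendsto_log_Gamma_sqrt_perturbation (u := fun n => (1 - γ) * √n) (c := 1 - γ)
    (d := 0) hα1' hy (by simp)
  have e6 := tendsto_log_Gamma_sqrt_perturbation (u := fun n => √n + 1) (c := 1) (d := 1) one_pos
    hn (by simp)
  have e7 := tendsto_log_Gamma_sqrt_perturbation (u := fun n => γ * √n) (c := γ) (d := 0)
    (mul_pos hν hα0) (scale hx) (by simp)
  have e8 := tendsto_log_Gamma_sqrt_perturbation (u := fun n => (1 - γ) * √n) (c := 1 - γ)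
    (d := 0) (mul_pos hν hα1') (scale hy) (by simp)
  have e9 := tendsto_log_Gamma_sqrt_perturbation (u := fun n => √n + 1) (c := 1) (d := 1)
    (mul_pos hν one_pos) (scale hn) (by simp)
  have lx := tendsto_log_sub_log_natCast hα0 hx
  have ly := tendsto_log_sub_log_natCast hα1' hy
  have key := ((((((e1.add e2).sub e3).const_mul (1 - ν)).sub ((e4.add e5).sub e6)).add
    ((e7.add e8).sub e9)).add_const (-(1 / 2) * log ν)).const_mul (1 - ν)⁻¹ |>.add
    (((lx.sub_const (log α)).add (ly.sub_const (log (1 - α)))).const_mul (1 / 2))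
  refine (key.congr' ?_).trans_eq ?_
  · filter_upwards [eventually_gt_atTop 0,
      (tendsto_atTop_of_div_natCast hα0 hx).eventually_gt_atTop 0,
      (tendsto_atTop_of_div_natCast hα1' hy).eventually_gt_atTop 0] with n hn0 hx0 hy0
    have hxn : ⌊α * n⌋₊ ≤ n := by
      have : (⌊α * n⌋₊ : ℝ) ≤ n := by linarith
      exact_mod_cast this
    have hn0' : (0 : ℝ) < n := Nat.cast_pos.2 hn0
    rw [weightedRenyiEntropy, log_setIntegral_weightPhi_mul_betaDensity_rpow hxn hγ hν,
      log_div (by positivity) hn0'.ne', log_mul (by positivity) hα1'.ne',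
      log_mul (by positivity) hα0.ne', log_mul hν.ne' hx0.ne', log_mul hν.ne' hy0.ne',
      log_mul hν.ne' hn0'.ne']
    field_simp
    ring
  · congr 1
    field_simp
    ring
end

section
/- Let X be a continuous real random variable with probability density f, and let φ be a non-negative weight function with ∫ φ(x)·f(x) dx = 1. For ν > 0, ν ≠ 1, such that ∫ φ(x)·(f(x))^ν dx < ∞ and ∫ φ(x)·(f(x))^ν·|log f(x)| dx < ∞, the weighted Rényi entropy H_ν^{φ}(f) = (1−ν)^{−1}·log ∫ φ(x)·(f(x))^ν dx satisfies (d/dν) H_ν^{φ}(f) = −(1−ν)^{−2} · ∫ z(x)·log( z(x)/( φ(x)·f(x) ) ) dx = −(1−ν)^{−2}·D( z ‖ φ·f ) ≤ 0, where z(x) = φ(x)·(f(x))^ν / ∫ φ(x)·(f(x))^ν dx. In particular H_ν^{φ}(f) is a non-increasing function of ν. -/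
open MeasureTheory Real Filter

/-- Differentiation under the integral sign for `t ↦ ∫ φ f ^ t`. -/
theorem hasDerivAt_integral_mul_rpow {f φ : ℝ → ℝ}
    (hf0 : ∀ x, 0 ≤ f x) (hφ0 : ∀ x, 0 ≤ φ x) (hf : AEMeasurable f)
    (hint : ∀ ν : ℝ, 0 < ν → Integrable (fun x => φ x * f x ^ ν))
    (hlogint : ∀ ν : ℝ, 0 < ν →
      Integrable (fun x => φ x * f x ^ ν * |Real.log (f x)|)) {ν : ℝ} (hν : 0 < ν) :
    Integrable (fun x => φ x * f x ^ ν * Real.log (f x)) ∧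
      HasDerivAt (fun t : ℝ => ∫ x, φ x * f x ^ t)
        (∫ x, φ x * f x ^ ν * Real.log (f x)) ν := by
  have hball : ∀ t ∈ Metric.ball ν (ν / 2), ν / 2 < t ∧ t < 3 * ν / 2 := by
    intro t ht
    rw [Metric.mem_ball, Real.dist_eq, abs_lt] at ht
    constructor <;> linarith [ht.1, ht.2]
  refine hasDerivAt_integral_of_dominated_loc_of_deriv_le (μ := volume)
    (F := fun t x => φ x * f x ^ t) (F' := fun t x => φ x * f x ^ t * Real.log (f x))
    (bound := fun x => φ x * f x ^ (ν / 2) * |Real.log (f x)| +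
      φ x * f x ^ (3 * ν / 2) * |Real.log (f x)|)
    (Metric.ball_mem_nhds ν (half_pos hν)) ?_ (hint ν hν) ?_ ?_ ?_ ?_
  · filter_upwards [lt_mem_nhds hν] with t ht using (hint t ht).aestronglyMeasurable
  · exact (hint ν hν).aestronglyMeasurable.mul
      (Real.measurable_log.comp_aemeasurable hf).aestronglyMeasurable
  · refine ae_of_all _ fun x t ht => ?_
    obtain ⟨h1, h2⟩ := hball t ht
    have hp : f x ^ t ≤ f x ^ (ν / 2) + f x ^ (3 * ν / 2) := by
      rcases (hf0 x).eq_or_lt with h0 | h0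
      · rw [← h0, Real.zero_rpow (by linarith)]
        positivity
      · rcases le_total (f x) 1 with h | h
        · linarith [Real.rpow_le_rpow_of_exponent_ge h0 h h1.le,
            Real.rpow_nonneg (hf0 x) (3 * ν / 2)]
        · linarith [Real.rpow_le_rpow_of_exponent_le h h2.le,
            Real.rpow_nonneg (hf0 x) (ν / 2)]
    rw [Real.norm_eq_abs, abs_mul,
      abs_of_nonneg (mul_nonneg (hφ0 x) (Real.rpow_nonneg (hf0 x) t)), ← add_mul, ← mul_add]
    gcongr
    exact hφ0 x
  · exact (hlogint _ (by linarith)).add (hlogint _ (by linarith))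
  · refine ae_of_all _ fun x t ht => ?_
    obtain ⟨h1, -⟩ := hball t ht
    have ht0 : 0 < t := by linarith
    rcases (hf0 x).eq_or_lt with h0 | h0
    · simp only [← h0, Real.log_zero, mul_zero]
      refine (hasDerivAt_const t (0 : ℝ)).congr_of_eventuallyEq ?_
      filter_upwards [lt_mem_nhds ht0] with s hs
      simp [Real.zero_rpow hs.ne']
    · simpa [mul_assoc] using
        (Real.hasStrictDerivAt_const_rpow h0 t).hasDerivAt.const_mul (φ x)

theorem integral_mul_rpow_pos {f φ : ℝ → ℝ}
    (hf0 : ∀ x, 0 ≤ f x) (hφ0 : ∀ x, 0 ≤ φ x) (hpos : 0 < ∫ x, φ x * f x)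
    (hint : ∀ ν : ℝ, 0 < ν → Integrable (fun x => φ x * f x ^ ν)) {ν : ℝ} (hν : 0 < ν) :
    0 < ∫ x, φ x * f x ^ ν := by
  have hnn : 0 ≤ fun x => φ x * f x ^ ν := fun x =>
    mul_nonneg (hφ0 x) (Real.rpow_nonneg (hf0 x) ν)
  refine lt_of_le_of_ne (integral_nonneg hnn) fun h => hpos.ne' ?_
  refine integral_eq_zero_of_ae ?_
  filter_upwards [(integral_eq_zero_iff_of_nonneg hnn (hint ν hν)).1 h.symm] with x hx
  rcases mul_eq_zero.1 hx with h | h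
  · simp [h]
  · simp [((Real.rpow_eq_zero_iff_of_nonneg (hf0 x)).1 h).1]

/-- Log-convexity (Lyapunov's inequality) of `t ↦ ∫ φ f ^ t`. -/
theorem convexOn_log_integral_mul_rpow {f φ : ℝ → ℝ}
    (hf0 : ∀ x, 0 ≤ f x) (hφ0 : ∀ x, 0 ≤ φ x) (hpos : 0 < ∫ x, φ x * f x)
    (hint : ∀ ν : ℝ, 0 < ν → Integrable (fun x => φ x * f x ^ ν)) :
    ConvexOn ℝ (Set.Ioi 0) (fun t : ℝ => Real.log (∫ x, φ x * f x ^ t)) := by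
  refine convexOn_iff_forall_pos.2 ⟨convex_Ioi 0, fun s hs t ht a b ha hb hab => ?_⟩
  have hs : 0 < s := hs
  have ht : 0 < t := ht
  have hIs := integral_mul_rpow_pos hf0 hφ0 hpos hint hs
  have hIt := integral_mul_rpow_pos hf0 hφ0 hpos hint ht
  have hst : 0 < a * s + b * t := by positivity
  have hIst := integral_mul_rpow_pos hf0 hφ0 hpos hint hst
  simp only [smul_eq_mul]
  set A := ∫ x, φ x * f x ^ s with hA
  set B := ∫ x, φ x * f x ^ t with hB
  have hpt : ∀ x, φ x * f x ^ (a * s + b * t) / (A ^ a * B ^ b) ≤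
      a * (φ x * f x ^ s / A) + b * (φ x * f x ^ t / B) := by
    intro x
    have hx := hφ0 x
    have hy := hf0 x
    have hfs := Real.rpow_nonneg hy s
    have hft := Real.rpow_nonneg hy t
    convert Real.geom_mean_le_arith_mean2_weighted ha.le hb.le
      (show 0 ≤ φ x * f x ^ s / A by positivity)
      (show 0 ≤ φ x * f x ^ t / B by positivity) hab using 1
    rw [Real.div_rpow (by positivity) hIs.le, Real.div_rpow (by positivity) hIt.le,
      Real.mul_rpow hx hfs, Real.mul_rpow hx hft, ← Real.rpow_mul hy, ← Real.rpow_mul hy,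
      div_mul_div_comm, mul_mul_mul_comm, ← Real.rpow_add_of_nonneg hx ha.le hb.le,
      ← Real.rpow_add_of_nonneg hy (by positivity) (by positivity), hab, Real.rpow_one,
      mul_comm s, mul_comm t]
  have hle := integral_mono ((hint _ hst).div_const (A ^ a * B ^ b))
    ((((hint s hs).div_const A).const_mul a).add (((hint t ht).div_const B).const_mul b)) hpt
  simp only [Pi.add_apply] at hle
  rw [integral_add (((hint s hs).div_const A).const_mul a)
    (((hint t ht).div_const B).const_mul b), integral_const_mul, integral_const_mul,
    integral_div, integral_div, integral_div, ← hA, ← hB, div_self hIs.ne',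
    div_self hIt.ne', mul_one, mul_one, hab, div_le_one (by positivity)] at hle
  have hlog := Real.log_le_log hIst hle
  rwa [Real.log_mul (by positivity) (by positivity), Real.log_rpow hIs,
    Real.log_rpow hIt] at hlog

/-- Let `f` be a probability density on `ℝ` and `φ ≥ 0` a weight with
`∫ φ f = 1`. Assume the integrability conditions `∫ φ f^ν < ∞` and `∫ φ f^ν |log f| < ∞`
for every `ν > 0`. Then for every `ν > 0`, `ν ≠ 1`, the weighted Rényi entropy
`H_ν^φ(f) = (1-ν)⁻¹ log ∫ φ f^ν` has derivative
`-(1-ν)⁻² ∫ z log(z/(φ f))` in `ν` (where `z = φ f^ν / ∫ φ f^ν`), this derivative is `≤ 0`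
(being `-(1-ν)⁻²` times a Kullback–Leibler divergence), and `H_ν^φ(f)` is non-increasing
in `ν` on `{ν | 0 < ν ∧ ν ≠ 1}`. -/
theorem weighted_renyi_derivative
    (f φ : ℝ → ℝ)
    (hf0 : ∀ x, 0 ≤ f x) (hφ0 : ∀ x, 0 ≤ φ x)
    (hfint : Integrable f) (hfdens : ∫ x : ℝ, f x = 1)
    (hφfint : Integrable (fun x => φ x * f x)) (hnorm : ∫ x : ℝ, φ x * f x = 1)
    (hint : ∀ ν : ℝ, 0 < ν → Integrable (fun x => φ x * f x ^ ν))
    (hlogint : ∀ ν : ℝ, 0 < ν →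
      Integrable (fun x => φ x * f x ^ ν * |Real.log (f x)|)) :
    ∀ ν : ℝ, 0 < ν → ν ≠ 1 →
      (HasDerivAt (fun t : ℝ => (1 - t)⁻¹ * Real.log (∫ x : ℝ, φ x * f x ^ t))
        (-(1 - ν)⁻¹ ^ 2 *
          ∫ x : ℝ, (φ x * f x ^ ν / ∫ y : ℝ, φ y * f y ^ ν) *
            Real.log ((φ x * f x ^ ν / ∫ y : ℝ, φ y * f y ^ ν) / (φ x * f x))) ν) ∧
      (-(1 - ν)⁻¹ ^ 2 *
          ∫ x : ℝ, (φ x * f x ^ ν / ∫ y : ℝ, φ y * f y ^ ν) *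
            Real.log ((φ x * f x ^ ν / ∫ y : ℝ, φ y * f y ^ ν) / (φ x * f x)) ≤ 0) ∧
      AntitoneOn (fun t : ℝ => (1 - t)⁻¹ * Real.log (∫ x : ℝ, φ x * f x ^ t))
        {t : ℝ | 0 < t ∧ t ≠ 1} := by
  have hpos : 0 < ∫ x, φ x * f x := hnorm ▸ one_pos
  have hanti : AntitoneOn (fun t : ℝ => (1 - t)⁻¹ * Real.log (∫ x : ℝ, φ x * f x ^ t))
      {t : ℝ | 0 < t ∧ t ≠ 1} := by
    rintro s ⟨hs, hs1⟩ t ⟨ht, ht1⟩ hst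
    have h := (convexOn_log_integral_mul_rpow hf0 hφ0 hpos hint).secant_mono
      (Set.mem_Ioi.2 one_pos) hs ht hs1 ht1 hst
    simp only [Real.rpow_one, hnorm, Real.log_one, sub_zero] at h
    have key : ∀ r y : ℝ, (1 - r)⁻¹ * y = -(y / (r - 1)) := fun r y => by
      rw [← neg_sub r 1, inv_neg, neg_mul, div_eq_inv_mul]
    simpa only [key, neg_le_neg_iff] using h
  intro ν hν hν1
  suffices hderiv : HasDerivAt
      (fun t : ℝ => (1 - t)⁻¹ * Real.log (∫ x : ℝ, φ x * f x ^ t))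
      (-(1 - ν)⁻¹ ^ 2 *
        ∫ x : ℝ, (φ x * f x ^ ν / ∫ y : ℝ, φ y * f y ^ ν) *
          Real.log ((φ x * f x ^ ν / ∫ y : ℝ, φ y * f y ^ ν) / (φ x * f x))) ν by
    refine ⟨hderiv, ?_, hanti⟩
    have hnhds : {t : ℝ | 0 < t ∧ t ≠ 1} ∈ nhds ν :=
      (lt_mem_nhds hν).and (isOpen_ne.mem_nhds hν1)
    have h := hanti.derivWithin_nonpos (x := ν)
    rwa [derivWithin_of_mem_nhds hnhds, hderiv.deriv] at h
  obtain ⟨hI', hd⟩ := hasDerivAt_integral_mul_rpow hf0 hφ0 hfint.aemeasurable hint hlogint hν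
  have hI := integral_mul_rpow_pos hf0 hφ0 hpos hint hν
  have h1 : 1 - ν ≠ 0 := sub_ne_zero.2 hν1.symm
  have hval : ∫ x : ℝ, (φ x * f x ^ ν / ∫ y : ℝ, φ y * f y ^ ν) *
      Real.log ((φ x * f x ^ ν / ∫ y : ℝ, φ y * f y ^ ν) / (φ x * f x)) =
      (ν - 1) / (∫ y : ℝ, φ y * f y ^ ν) * (∫ x, φ x * f x ^ ν * Real.log (f x)) -
        Real.log (∫ y : ℝ, φ y * f y ^ ν) := by
    set I := ∫ y : ℝ, φ y * f y ^ ν with hIdef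
    have hpt : ∀ x, (φ x * f x ^ ν / I) * Real.log ((φ x * f x ^ ν / I) / (φ x * f x)) =
        (ν - 1) / I * (φ x * f x ^ ν * Real.log (f x)) -
          Real.log I / I * (φ x * f x ^ ν) := by
      intro x
      rcases (hφ0 x).eq_or_lt with h | hφ
      · simp [← h]
      rcases (hf0 x).eq_or_lt with h | hf
      · simp [← h, Real.zero_rpow hν.ne']
      have hfν := Real.rpow_pos_of_pos hf ν
      rw [Real.log_div (by positivity) (by positivity),
        Real.log_div (by positivity) hI.ne', Real.log_mul hφ.ne' hfν.ne',
        Real.log_mul hφ.ne' hf.ne', Real.log_rpow hf]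
      ring
    simp_rw [hpt]
    rw [integral_sub (hI'.const_mul _) ((hint ν hν).const_mul _), integral_const_mul,
      integral_const_mul, ← hIdef, div_mul_cancel₀ _ hI.ne']
  rw [hval]
  refine ((((hasDerivAt_id ν).const_sub 1).inv h1).mul (hd.log hI.ne')).congr_deriv ?_
  simp only [Pi.inv_apply, id_eq]
  generalize (∫ x, φ x * f x ^ ν * Real.log (f x)) = J
  field_simp
  ring
end

section
/- For n ≥ 1 and α ∈ (0,1), define the real-parameter family of Beta densities f(p; α) = ( Γ(n+2) / ( Γ(αn+1)·Γ((1−α)n+1) ) )·p^{αn}·(1−p)^{(1−α)n} for p ∈ (0,1), and the Fisher information I_n(α) = ∫₀¹ ( ∂/∂α log f(p;α) )² · f(p;α) dp. Then (i) I_n(α) = n²·( ψ₁(αn+1) + ψ₁((1−α)n+1) ), where ψ₁ is the trigamma function (the derivative of the digamma function), and (ii) lim_{n→∞} [ I_n(α) − n/( α(1−α) ) ] = −( 2α² − 2α + 1 ) / ( 2α²(1−α)² ). -/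
open MeasureTheory Real Filter

/-- The digamma function `ψ(x) = (d/dx) log Γ(x)`. -/
noncomputable def digamma (x : ℝ) : ℝ :=
  deriv (fun y => Real.log (Real.Gamma y)) x

/-- The trigamma function `ψ₁ = ψ'`. -/
noncomputable def trigamma (x : ℝ) : ℝ :=
  deriv digamma x

/-- The real-parameter Beta(αn+1, (1-α)n+1) density `f(p;α)` on `(0,1)`. -/
noncomputable def betaDensR (n : ℕ) (a p : ℝ) : ℝ :=
  Real.Gamma ((n : ℝ) + 2) / (Real.Gamma (a * n + 1) * Real.Gamma ((1 - a) * n + 1)) *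
    p ^ (a * (n : ℝ)) * (1 - p) ^ ((1 - a) * (n : ℝ))

/-- Fisher information `I_n(α) = ∫₀¹ (∂_α log f(p;α))² f(p;α) dp`. -/
noncomputable def fisherInfo (n : ℕ) (α : ℝ) : ℝ :=
  ∫ p in Set.Ioo (0 : ℝ) 1,
    (deriv (fun a => Real.log (betaDensR n a p)) α) ^ 2 * betaDensR n α p

theorem analyticAt_log_Gamma {x : ℝ} (hx : 0 < x) :
    AnalyticAt ℝ (fun y => Real.log (Real.Gamma y)) x := by
  have h : DifferentiableOn ℂ Complex.Gamma {z : ℂ | 0 < z.re} := fun z hz =>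
    (Complex.differentiableAt_Gamma z fun m hm => by
      have := congrArg Complex.re hm
      simp only [Complex.neg_re, Complex.natCast_re] at this
      have hz' : 0 < z.re := hz
      linarith [Nat.cast_nonneg (α := ℝ) m]).differentiableWithinAt
  have hnhds : {z : ℂ | 0 < z.re} ∈ nhds (x : ℂ) :=
    (isOpen_lt continuous_const Complex.continuous_re).mem_nhds (by simpa using hx)
  exact (h.analyticAt hnhds).re_ofReal.log (Real.Gamma_pos_of_pos hx)

theorem hasDerivAt_log_Gamma {x : ℝ} (hx : 0 < x) :
    HasDerivAt (fun y => Real.log (Real.Gamma y)) (digamma x) x :=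
  (analyticAt_log_Gamma hx).differentiableAt.hasDerivAt

theorem hasDerivAt_digamma {x : ℝ} (hx : 0 < x) : HasDerivAt digamma (trigamma x) x :=
  (analyticAt_log_Gamma hx).deriv.differentiableAt.hasDerivAt

theorem digamma_add_one {x : ℝ} (hx : 0 < x) : digamma (x + 1) = digamma x + x⁻¹ := by
  have h₁ : HasDerivAt (fun y => Real.log (Real.Gamma (y + 1))) (digamma (x + 1)) x :=
    (hasDerivAt_log_Gamma (by linarith : 0 < x + 1)).comp_add_const x 1
  have h₂ : HasDerivAt (fun y => Real.log (Real.Gamma y) + Real.log y) (digamma x + x⁻¹) x :=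
    (hasDerivAt_log_Gamma hx).add (Real.hasDerivAt_log hx.ne')
  refine h₁.unique (h₂.congr_of_eventuallyEq ?_)
  filter_upwards [eventually_gt_nhds hx] with y hy
  rw [Real.Gamma_add_one hy.ne', Real.log_mul hy.ne' (Real.Gamma_pos_of_pos hy).ne', add_comm]

theorem trigamma_add_one {x : ℝ} (hx : 0 < x) : trigamma (x + 1) = trigamma x - 1 / x ^ 2 := by
  have h₁ : HasDerivAt (fun y => digamma (y + 1)) (trigamma (x + 1)) x :=
    (hasDerivAt_digamma (by linarith : 0 < x + 1)).comp_add_const x 1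
  have h₂ : HasDerivAt (fun y => digamma y + y⁻¹) (trigamma x + -(x ^ 2)⁻¹) x :=
    (hasDerivAt_digamma hx).add (hasDerivAt_inv hx.ne')
  rw [h₁.unique (h₂.congr_of_eventuallyEq ?_)]
  · rw [one_div, sub_eq_add_neg]
  filter_upwards [eventually_gt_nhds hx] with y hy using digamma_add_one hy

section BetaMeasure

open ProbabilityTheory

theorem betaPDFReal_nonneg {a b : ℝ} (ha : 0 < a) (hb : 0 < b) (p : ℝ) :
    0 ≤ betaPDFReal a b p := by
  by_cases h : 0 < p ∧ p < 1
  · exact (betaPDFReal_pos h.1 h.2 ha hb).le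
  · simp [betaPDFReal, h]

theorem measurable_betaPDF (a b : ℝ) : Measurable (betaPDF a b) :=
  (measurable_betaPDFReal a b).ennreal_ofReal

theorem integrable_betaPDFReal {a b : ℝ} (ha : 0 < a) (hb : 0 < b) :
    Integrable (betaPDFReal a b) := by
  rw [← lintegral_ofReal_ne_top_iff_integrable (by fun_prop)
    (.of_forall (betaPDFReal_nonneg ha hb))]
  exact (lintegral_betaPDF_eq_one ha hb).trans_ne ENNReal.one_ne_top

theorem integral_betaPDFReal {a b : ℝ} (ha : 0 < a) (hb : 0 < b) :
    ∫ p, betaPDFReal a b p = 1 := by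
  rw [integral_eq_lintegral_of_nonneg_ae (.of_forall (betaPDFReal_nonneg ha hb)) (by fun_prop)]
  exact (congrArg ENNReal.toReal (lintegral_betaPDF_eq_one ha hb)).trans ENNReal.toReal_one

theorem integrable_betaMeasure_iff {a b : ℝ} (ha : 0 < a) (hb : 0 < b) (g : ℝ → ℝ) :
    Integrable g (betaMeasure a b) ↔ Integrable fun p => g p * betaPDFReal a b p := by
  rw [betaMeasure, integrable_withDensity_iff (measurable_betaPDF a b) (by simp [betaPDF])]
  simp only [betaPDF, ENNReal.toReal_ofReal (betaPDFReal_nonneg ha hb _)]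

theorem integral_betaMeasure {a b : ℝ} (ha : 0 < a) (hb : 0 < b) (g : ℝ → ℝ) :
    ∫ p, g p ∂betaMeasure a b = ∫ p, g p * betaPDFReal a b p := by
  rw [betaMeasure, integral_withDensity_eq_integral_toReal_smul (measurable_betaPDF a b)
    (by simp [betaPDF])]
  refine integral_congr_ae (.of_forall fun p => ?_)
  simp only [betaPDF, ENNReal.toReal_ofReal (betaPDFReal_nonneg ha hb p), smul_eq_mul, mul_comm]

/-- The log-odds function on the unit interval. -/
noncomputable def logOdds (p : ℝ) : ℝ := Real.log p - Real.log (1 - p)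

theorem exp_mul_logOdds_mul_betaPDFReal {a b t : ℝ} (ha : 0 < a + t) (hb : 0 < b - t) (p : ℝ) :
    Real.exp (t * logOdds p) * betaPDFReal a b p =
      beta (a + t) (b - t) / beta a b * betaPDFReal (a + t) (b - t) p := by
  by_cases h : 0 < p ∧ p < 1
  · have hp : 0 < 1 - p := by linarith
    simp only [betaPDFReal, if_pos h, logOdds, Real.rpow_def_of_pos h.1, Real.rpow_def_of_pos hp]
    have hβ := (beta_pos ha hb).ne'
    have e : Real.exp (Real.log p * (a + t - 1)) * Real.exp (Real.log (1 - p) * (b - t - 1)) =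
        Real.exp (t * (Real.log p - Real.log (1 - p))) * Real.exp (Real.log p * (a - 1)) *
          Real.exp (Real.log (1 - p) * (b - 1)) := by
      rw [← Real.exp_add, ← Real.exp_add, ← Real.exp_add]; ring_nf
    field_simp
    linear_combination -(beta a b)⁻¹ * e
  · simp [betaPDFReal, h]

theorem integrable_exp_mul_logOdds {a b t : ℝ} (ha : 0 < a) (hb : 0 < b) (hat : 0 < a + t)
    (hbt : 0 < b - t) : Integrable (fun p => Real.exp (t * logOdds p)) (betaMeasure a b) := by
  rw [integrable_betaMeasure_iff ha hb]
  simp only [exp_mul_logOdds_mul_betaPDFReal hat hbt]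
  exact (integrable_betaPDFReal hat hbt).const_mul _

theorem mgf_logOdds {a b t : ℝ} (ha : 0 < a) (hb : 0 < b) (hat : 0 < a + t) (hbt : 0 < b - t) :
    mgf logOdds (betaMeasure a b) t = beta (a + t) (b - t) / beta a b := by
  rw [mgf, integral_betaMeasure ha hb]
  simp only [exp_mul_logOdds_mul_betaPDFReal hat hbt]
  rw [integral_const_mul, integral_betaPDFReal hat hbt, mul_one]

theorem zero_mem_interior_integrableExpSet_logOdds {a b : ℝ} (ha : 0 < a) (hb : 0 < b) :
    0 ∈ interior (integrableExpSet logOdds (betaMeasure a b)) :=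
  mem_interior.2 ⟨Set.Ioo (-a) b,
    fun _ ht => integrable_exp_mul_logOdds ha hb (by linarith [ht.1]) (by linarith [ht.2]),
    isOpen_Ioo, by simp [ha, hb]⟩

theorem cgf_logOdds {a b t : ℝ} (ha : 0 < a) (hb : 0 < b) (hat : 0 < a + t) (hbt : 0 < b - t) :
    cgf logOdds (betaMeasure a b) t =
      Real.log (Real.Gamma (a + t)) + Real.log (Real.Gamma (b - t)) -
        Real.log (Real.Gamma (a + b)) - Real.log (beta a b) := by
  have h₁ := (Real.Gamma_pos_of_pos hat).ne'
  have h₂ := (Real.Gamma_pos_of_pos hbt).ne'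
  have h₃ := (Real.Gamma_pos_of_pos (add_pos ha hb)).ne'
  rw [cgf, mgf_logOdds ha hb hat hbt, Real.log_div (beta_pos hat hbt).ne' (beta_pos ha hb).ne',
    beta, show a + t + (b - t) = a + b by ring, Real.log_div (mul_ne_zero h₁ h₂) h₃,
    Real.log_mul h₁ h₂]

theorem hasDerivAt_cgf_logOdds {a b t : ℝ} (ha : 0 < a) (hb : 0 < b) (ht : t ∈ Set.Ioo (-a) b) :
    HasDerivAt (cgf logOdds (betaMeasure a b)) (digamma (a + t) - digamma (b - t)) t := by
  have h := (((hasDerivAt_log_Gamma (by linarith [ht.1] : 0 < a + t)).comp_const_add a t).add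
    ((hasDerivAt_log_Gamma (by linarith [ht.2] : 0 < b - t)).comp_const_sub b t)).sub_const
      (Real.log (Real.Gamma (a + b))) |>.sub_const (Real.log (beta a b))
  rw [← sub_eq_add_neg] at h
  refine h.congr_of_eventuallyEq ?_
  filter_upwards [isOpen_Ioo.mem_nhds ht] with s hs
  exact cgf_logOdds ha hb (by linarith [hs.1]) (by linarith [hs.2])

theorem iteratedDeriv_two_cgf_logOdds {a b : ℝ} (ha : 0 < a) (hb : 0 < b) :
    iteratedDeriv 2 (cgf logOdds (betaMeasure a b)) 0 = trigamma a + trigamma b := by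
  rw [iteratedDeriv_succ, iteratedDeriv_one]
  have h₁ : HasDerivAt (fun t => digamma (a + t)) (trigamma a) 0 := by
    simpa using (hasDerivAt_digamma (by simpa using ha : 0 < a + 0)).comp_const_add a 0
  have h₂ : HasDerivAt (fun t => digamma (b - t)) (-trigamma b) 0 := by
    simpa using (hasDerivAt_digamma (by simpa using hb : 0 < b - 0)).comp_const_sub b 0
  have h := h₁.sub h₂
  rw [sub_neg_eq_add] at h
  refine (h.congr_of_eventuallyEq ?_).deriv
  filter_upwards [Ioo_mem_nhds (neg_lt_zero.2 ha) hb] with t ht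
  exact (hasDerivAt_cgf_logOdds ha hb ht).deriv

/-- The variance of the log-odds of a beta random variable. -/
theorem integral_sq_logOdds_sub {a b : ℝ} (ha : 0 < a) (hb : 0 < b) :
    ∫ p, (logOdds p - (digamma a - digamma b)) ^ 2 ∂betaMeasure a b =
      trigamma a + trigamma b := by
  have := isProbabilityMeasureBeta ha hb
  have hd : deriv (cgf logOdds (betaMeasure a b)) 0 = digamma a - digamma b := by
    simpa using (hasDerivAt_cgf_logOdds ha hb ⟨neg_lt_zero.2 ha, hb⟩).deriv
  rw [← iteratedDeriv_two_cgf_logOdds ha hb, iteratedDeriv_two_cgf_eq_integral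
    (zero_mem_interior_integrableExpSet_logOdds ha hb), hd]
  simp

theorem trigamma_nonneg {x : ℝ} (hx : 0 < x) : 0 ≤ trigamma x := by
  have : 0 ≤ trigamma x + trigamma x :=
    integral_sq_logOdds_sub hx hx ▸ integral_nonneg fun p => sq_nonneg _
  linarith

theorem sq_le_exp_add_exp_neg_sub_two (y : ℝ) :
    y ^ 2 ≤ Real.exp y + Real.exp (-y) - 2 := by
  have h : |y / 2| ≤ |Real.sinh (y / 2)| := by
    rw [Real.abs_sinh]
    exact Real.self_le_sinh_iff.2 (abs_nonneg _)
  have h₁ := sq_le_sq.2 h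
  have h₂ := Real.cosh_two_mul (y / 2)
  rw [Real.cosh_sq, mul_div_cancel₀ y two_ne_zero, Real.cosh_eq] at h₂
  linarith

theorem trigamma_le_one_div_sub_one {x : ℝ} (hx : 1 < x) : trigamma x ≤ 1 / (x - 1) := by
  have hx₀ : 0 < x := by linarith
  have hx₁ : 0 < x - 1 := by linarith
  have := isProbabilityMeasureBeta hx₀ hx₀
  have hv := integral_sq_logOdds_sub hx₀ hx₀
  simp only [sub_self, sub_zero] at hv
  have i₁ := integrable_exp_mul_logOdds (t := 1) hx₀ hx₀ (by linarith) hx₁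
  have i₂ := integrable_exp_mul_logOdds (t := -1) hx₀ hx₀ hx₁ (by linarith)
  have m₁ := mgf_logOdds (t := 1) hx₀ hx₀ (by linarith) hx₁
  have m₂ := mgf_logOdds (t := -1) hx₀ hx₀ hx₁ (by linarith)
  have hβ : beta (x + 1) (x - 1) / beta x x = x / (x - 1) := by
    have h := Real.Gamma_add_one hx₁.ne'
    rw [sub_add_cancel] at h
    have g := (Real.Gamma_pos_of_pos hx₁).ne'
    have g' := (Real.Gamma_pos_of_pos (by linarith : 0 < x + x)).ne'
    rw [beta, beta, Real.Gamma_add_one hx₀.ne', show x + 1 + (x - 1) = x + x by ring, h]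
    field_simp
  have hβ' : beta (x + -1) (x - -1) = beta (x + 1) (x - 1) := by
    rw [beta, beta, ← sub_eq_add_neg, sub_neg_eq_add, mul_comm, add_comm (x - 1)]
  rw [hβ] at m₁
  rw [hβ', hβ] at m₂
  have hle : ∫ p, logOdds p ^ 2 ∂betaMeasure x x ≤
      ∫ p, (Real.exp (1 * logOdds p) + Real.exp (-1 * logOdds p) - 2) ∂betaMeasure x x := by
    refine integral_mono_of_nonneg (.of_forall fun p => sq_nonneg _)
      ((i₁.add i₂).sub (integrable_const 2)) (.of_forall fun p => ?_)
    simpa using sq_le_exp_add_exp_neg_sub_two (logOdds p)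
  rw [integral_sub (by exact i₁.add i₂) (integrable_const 2), integral_add i₁ i₂,
    integral_const] at hle
  simp only [mgf] at m₁ m₂
  rw [m₁, m₂, hv, probReal_univ, one_smul] at hle
  have : x / (x - 1) = 1 + 1 / (x - 1) := by field_simp; ring
  linarith

end BetaMeasure

theorem tendsto_trigamma_atTop : Tendsto trigamma atTop (nhds 0) := by
  refine tendsto_of_tendsto_of_tendsto_of_le_of_le' tendsto_const_nhds
    (tendsto_const_nhds.div_atTop (tendsto_atTop_add_const_right _ (-1 : ℝ) tendsto_id) :
      Tendsto (fun x : ℝ => 1 / (id x + -1)) atTop (nhds 0)) ?_ ?_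
  · filter_upwards [eventually_gt_atTop 0] with x hx using trigamma_nonneg hx
  · filter_upwards [eventually_gt_atTop 1] with x hx using trigamma_le_one_div_sub_one hx

/-- A function on the positive reals that tends to `0` at infinity and decreases along unit steps
is nonnegative. -/
theorem nonneg_of_add_one_le_of_tendsto_zero {h : ℝ → ℝ}
    (hstep : ∀ x, 0 < x → h (x + 1) ≤ h x) (hlim : Tendsto h atTop (nhds 0)) {x : ℝ}
    (hx : 0 < x) : 0 ≤ h x := by
  have hanti : Antitone fun k : ℕ => h (x + k) := antitone_nat_of_succ_le fun k => by
    have := hstep (x + k) (by positivity)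
    rwa [add_assoc, ← Nat.cast_add_one] at this
  have ht : Tendsto (fun k : ℕ => h (x + k)) atTop (nhds 0) :=
    hlim.comp (tendsto_atTop_add_const_left _ x tendsto_natCast_atTop_atTop)
  simpa using hanti.le_of_tendsto ht 0

theorem tendsto_trigamma_add_one_atTop :
    Tendsto (fun x => trigamma (x + 1)) atTop (nhds 0) :=
  tendsto_trigamma_atTop.comp (tendsto_atTop_add_const_right _ 1 tendsto_id)

theorem tendsto_const_div_mul_pow_atTop (c d : ℝ) (hd : 0 < d) {k : ℕ} (hk : k ≠ 0) :
    Tendsto (fun x : ℝ => c / (d * x ^ k)) atTop (nhds 0) :=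
  tendsto_const_nhds.div_atTop ((tendsto_pow_atTop hk).const_mul_atTop hd)

theorem le_trigamma_add_one {x : ℝ} (hx : 0 < x) :
    1 / x - 1 / (2 * x ^ 2) ≤ trigamma (x + 1) := by
  have hlim : Tendsto (fun y => trigamma (y + 1) - (1 / (1 * y ^ 1) - 1 / (2 * y ^ 2))) atTop
      (nhds 0) := by
    simpa only [sub_zero] using tendsto_trigamma_add_one_atTop.sub
      ((tendsto_const_div_mul_pow_atTop 1 1 one_pos one_ne_zero).sub
        (tendsto_const_div_mul_pow_atTop 1 2 two_pos two_ne_zero))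
  have := nonneg_of_add_one_le_of_tendsto_zero (fun y hy => ?_) hlim hx
  · simpa using this
  have e : 1 / (1 * y ^ 1) - 1 / (2 * y ^ 2) -
      (1 / (1 * (y + 1) ^ 1) - 1 / (2 * (y + 1) ^ 2)) =
        1 / (y + 1) ^ 2 - 1 / (2 * y ^ 2 * (y + 1) ^ 2) := by
    field_simp
    ring
  have : 0 < 1 / (2 * y ^ 2 * (y + 1) ^ 2) := by positivity
  rw [trigamma_add_one (by linarith : 0 < y + 1)]
  linarith

theorem trigamma_add_one_le {x : ℝ} (hx : 0 < x) :
    trigamma (x + 1) ≤ 1 / x - 1 / (2 * x ^ 2) + 1 / (6 * x ^ 3) := by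
  have hlim : Tendsto (fun y => 1 / (1 * y ^ 1) - 1 / (2 * y ^ 2) + 1 / (6 * y ^ 3) -
      trigamma (y + 1)) atTop (nhds 0) := by
    simpa only [sub_zero, add_zero] using
      (((tendsto_const_div_mul_pow_atTop 1 1 one_pos one_ne_zero).sub
        (tendsto_const_div_mul_pow_atTop 1 2 two_pos two_ne_zero)).add
        (tendsto_const_div_mul_pow_atTop 1 6 (by norm_num) three_ne_zero)).sub
        tendsto_trigamma_add_one_atTop
  have := nonneg_of_add_one_le_of_tendsto_zero (fun y hy => ?_) hlim hx
  · simpa using this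
  have e : 1 / (1 * y ^ 1) - 1 / (2 * y ^ 2) + 1 / (6 * y ^ 3) -
      (1 / (1 * (y + 1) ^ 1) - 1 / (2 * (y + 1) ^ 2) + 1 / (6 * (y + 1) ^ 3)) =
        1 / (y + 1) ^ 2 + 1 / (6 * y ^ 3 * (y + 1) ^ 3) := by
    field_simp
    ring
  have : 0 < 1 / (6 * y ^ 3 * (y + 1) ^ 3) := by positivity
  rw [trigamma_add_one (by linarith : 0 < y + 1)]
  linarith

theorem tendsto_sq_mul_trigamma_sub {a : ℝ} (ha : 0 < a) :
    Tendsto (fun n : ℕ => (n : ℝ) ^ 2 * trigamma (a * n + 1) - n / a) atTop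
      (nhds (-1 / (2 * a ^ 2))) := by
  have hu : Tendsto (fun n : ℕ => -1 / (2 * a ^ 2) + 1 / (6 * a ^ 3 * (n : ℝ) ^ 1)) atTop
      (nhds (-1 / (2 * a ^ 2))) := by
    simpa only [add_zero, Function.comp_apply] using tendsto_const_nhds.add
      ((tendsto_const_div_mul_pow_atTop 1 (6 * a ^ 3) (by positivity) one_ne_zero).comp
        tendsto_natCast_atTop_atTop)
  refine tendsto_of_tendsto_of_tendsto_of_le_of_le' tendsto_const_nhds hu ?_ ?_
  · filter_upwards [eventually_gt_atTop 0] with n hn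
    have hn' : (0 : ℝ) < n := Nat.cast_pos.2 hn
    have h := mul_le_mul_of_nonneg_left (le_trigamma_add_one (mul_pos ha hn'))
      (sq_nonneg (n : ℝ))
    have e : (n : ℝ) ^ 2 * (1 / (a * n) - 1 / (2 * (a * n) ^ 2)) = n / a + -1 / (2 * a ^ 2) := by
      field_simp
      ring
    linarith
  · filter_upwards [eventually_gt_atTop 0] with n hn
    have hn' : (0 : ℝ) < n := Nat.cast_pos.2 hn
    have h := mul_le_mul_of_nonneg_left (trigamma_add_one_le (mul_pos ha hn'))
      (sq_nonneg (n : ℝ))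
    have e : (n : ℝ) ^ 2 * (1 / (a * n) - 1 / (2 * (a * n) ^ 2) + 1 / (6 * (a * n) ^ 3)) =
        n / a + (-1 / (2 * a ^ 2) + 1 / (6 * a ^ 3 * (n : ℝ) ^ 1)) := by
      field_simp
      ring
    linarith

open ProbabilityTheory in
theorem betaDensR_eq_betaPDFReal (n : ℕ) (a : ℝ) {p : ℝ} (hp : p ∈ Set.Ioo (0 : ℝ) 1) :
    betaDensR n a p = betaPDFReal (a * n + 1) ((1 - a) * n + 1) p := by
  rw [betaDensR, betaPDFReal, if_pos ⟨hp.1, hp.2⟩, beta, one_div_div]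
  ring_nf

theorem deriv_log_betaDensR {n : ℕ} {a p : ℝ} (ha : a ∈ Set.Ioo (0 : ℝ) 1)
    (hp : p ∈ Set.Ioo (0 : ℝ) 1) :
    deriv (fun a => Real.log (betaDensR n a p)) a =
      n * (logOdds p - (digamma (a * n + 1) - digamma ((1 - a) * n + 1))) := by
  have hp₁ : 0 < 1 - p := by linarith [hp.2]
  have pos₁ : ∀ c ∈ Set.Ioo (0 : ℝ) 1, 0 < c * n + 1 := fun c hc => by
    have := hc.1
    positivity
  have pos₂ : ∀ c ∈ Set.Ioo (0 : ℝ) 1, 0 < (1 - c) * n + 1 := fun c hc => by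
    have : 0 < 1 - c := by linarith [hc.2]
    positivity
  have d₁ : HasDerivAt (fun c : ℝ => c * n + 1) n a := by
    simpa using ((hasDerivAt_id a).mul_const (n : ℝ)).add_const 1
  have d₂ : HasDerivAt (fun c : ℝ => (1 - c) * n + 1) (-n) a := by
    simpa using (((hasDerivAt_id a).const_sub 1).mul_const (n : ℝ)).add_const 1
  have g₁ := (hasDerivAt_log_Gamma (pos₁ a ha)).comp a d₁
  have g₂ := (hasDerivAt_log_Gamma (pos₂ a ha)).comp a d₂
  have l₁ := (d₁.sub_const 1).mul_const (Real.log p)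
  have l₂ := (d₂.sub_const 1).mul_const (Real.log (1 - p))
  have h := (((g₁.add g₂).const_sub (Real.log (Real.Gamma ((n : ℝ) + 2)))).add l₁).add l₂
  refine (h.congr_of_eventuallyEq ?_).deriv.trans ?_
  · filter_upwards [isOpen_Ioo.mem_nhds ha] with c hc
    have z₀ : Real.Gamma ((n : ℝ) + 2) ≠ 0 := (Real.Gamma_pos_of_pos (by positivity)).ne'
    have z₁ := (Real.Gamma_pos_of_pos (pos₁ c hc)).ne'
    have z₂ := (Real.Gamma_pos_of_pos (pos₂ c hc)).ne'
    have r₁ := (Real.rpow_pos_of_pos hp.1 (c * (n : ℝ))).ne'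
    have r₂ := (Real.rpow_pos_of_pos hp₁ ((1 - c) * (n : ℝ))).ne'
    have z₁₂ := mul_ne_zero z₁ z₂
    rw [betaDensR, Real.log_mul (mul_ne_zero (div_ne_zero z₀ z₁₂) r₁) r₂,
      Real.log_mul (div_ne_zero z₀ z₁₂) r₁, Real.log_div z₀ z₁₂, Real.log_mul z₁ z₂,
      Real.log_rpow hp.1, Real.log_rpow hp₁]
    simp
  · rw [logOdds]
    ring

open ProbabilityTheory in
theorem fisherInfo_eq (n : ℕ) {a : ℝ} (ha : a ∈ Set.Ioo (0 : ℝ) 1) :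
    fisherInfo n a = (n : ℝ) ^ 2 * (trigamma (a * n + 1) + trigamma ((1 - a) * n + 1)) := by
  have h₁ : 0 < a * n + 1 := by
    have := ha.1
    positivity
  have h₂ : 0 < (1 - a) * n + 1 := by
    have : 0 < 1 - a := by linarith [ha.2]
    positivity
  rw [← integral_sq_logOdds_sub h₁ h₂, integral_betaMeasure h₁ h₂, ← integral_const_mul, fisherInfo]
  refine Eq.trans ?_
    (setIntegral_eq_integral_of_forall_compl_eq_zero (s := Set.Ioo (0 : ℝ) 1) fun p hp => ?_)
  · refine setIntegral_congr_fun measurableSet_Ioo fun p hp => ?_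
    simp only [deriv_log_betaDensR ha hp, betaDensR_eq_betaPDFReal n a hp]
    ring
  · have : ¬(0 < p ∧ p < 1) := hp
    simp [betaPDFReal, this]

/-- For `α ∈ (0,1)`:
(i) `I_n(α) = n² (ψ₁(αn+1) + ψ₁((1-α)n+1))` for every `n ≥ 1`, and
(ii) `I_n(α) - n/(α(1-α)) → -(2α² - 2α + 1)/(2α²(1-α)²)` as `n → ∞`. -/
theorem fisher_information_asymptotics (α : ℝ) (hα : α ∈ Set.Ioo (0 : ℝ) 1) :
    (∀ n : ℕ, 1 ≤ n →
      fisherInfo n α =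
        (n : ℝ) ^ 2 * (trigamma (α * n + 1) + trigamma ((1 - α) * n + 1))) ∧
    Tendsto (fun n : ℕ => fisherInfo n α - (n : ℝ) / (α * (1 - α))) atTop
      (nhds (-(2 * α ^ 2 - 2 * α + 1) / (2 * α ^ 2 * (1 - α) ^ 2))) := by
  refine ⟨fun n _ => fisherInfo_eq n hα, ?_⟩
  have h₀ : 0 < α := hα.1
  have h₁ : 0 < 1 - α := by linarith [hα.2]
  have h := (tendsto_sq_mul_trigamma_sub h₀).add (tendsto_sq_mul_trigamma_sub h₁)
  have e : -1 / (2 * α ^ 2) + -1 / (2 * (1 - α) ^ 2) =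
      -(2 * α ^ 2 - 2 * α + 1) / (2 * α ^ 2 * (1 - α) ^ 2) := by
    field_simp
    ring
  rw [← e]
  refine h.congr fun n => ?_
  rw [fisherInfo_eq n hα]
  field_simp
  ring
end

section
/- Fix α ∈ (0,1) and γ ∈ (0,1), set x = x(n) = ⌊αn⌋, and let Z_n have density f_{n,x}. Consider the weight function φ₃(p) = κ₃(α,γ)^{−1}·p^{γn}·(1−p)^{(1−γ)n} with κ₃(α,γ) = Γ(x+γn+1)·Γ(2n−x+1−γn)·Γ(n+2) / ( Γ(x+1)·Γ(n−x+1)·Γ(2n+2) ), so that ∫₀¹ φ₃(p)·f_{n,x}(p) dp = 1, and the weighted variance V^{φ₃}_n = ∫₀¹ (p − e_n)²·φ₃(p)·f_{n,x}(p) dp with e_n = (x+1)/(n+2) the (unweighted) mean of Z_n. Then there exist a constant C₃(α,γ) depending only on α and γ, a constant C > 0 and N such that for all n ≥ N, V^{φ₃}_n ≥ (α−γ)²/4 + C₃(α,γ)/n − C·n^{−3/2}. In particular the weighted-variance lower bound does not vanish as n → ∞ when α ≠ γ, its limit being at least (α−γ)²/4. -/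
open MeasureTheory Real Filter

/-- The normalizing constant `κ₃(α,γ)` for the weight `p^{γn} (1-p)^{(1-γ)n}`
(here `x = ⌊αn⌋`). -/
noncomputable def kappa3 (α γ : ℝ) (n : ℕ) : ℝ :=
  Real.Gamma ((Nat.floor (α * n) : ℝ) + γ * n + 1) *
    Real.Gamma (2 * (n : ℝ) - (Nat.floor (α * n) : ℝ) + 1 - γ * n) *
    Real.Gamma ((n : ℝ) + 2) /
  (Real.Gamma ((Nat.floor (α * n) : ℝ) + 1) *
    Real.Gamma ((n : ℝ) - (Nat.floor (α * n) : ℝ) + 1) *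
    Real.Gamma (2 * (n : ℝ) + 2))

/-- The weight function `φ₃(p) = κ₃(α,γ)⁻¹ p^{γn} (1-p)^{(1-γ)n}`. -/
noncomputable def phi3 (α γ : ℝ) (n : ℕ) (p : ℝ) : ℝ :=
  (kappa3 α γ n)⁻¹ * p ^ (γ * (n : ℝ)) * (1 - p) ^ ((1 - γ) * (n : ℝ))

/-- The weighted variance `V^{φ₃}_n = ∫₀¹ (p - e_n)² φ₃(p) f_{n,x}(p) dp`, with
`e_n = (x+1)/(n+2)` the unweighted mean. -/
noncomputable def weightedVar3 (α γ : ℝ) (n : ℕ) : ℝ :=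
  ∫ p in Set.Ioo (0 : ℝ) 1,
    (p - ((Nat.floor (α * n) : ℝ) + 1) / ((n : ℝ) + 2)) ^ 2 * phi3 α γ n p *
      betaDensity n (Nat.floor (α * n)) p

lemma integrableOn_rpow_mul_one_sub_rpow {a b : ℝ} (ha : 0 < a) (hb : 0 < b) :
    IntegrableOn (fun p : ℝ => p ^ (a - 1) * (1 - p) ^ (b - 1)) (Set.Ioo 0 1) := by
  have h := Complex.betaIntegral_convergent (u := a) (v := b) (by simpa) (by simpa)
  rw [intervalIntegrable_iff_integrableOn_Ioo_of_le zero_le_one] at h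
  refine (integrableOn_congr_fun (fun p hp => ?_) measurableSet_Ioo).mp h.re
  have hp' : 0 ≤ 1 - p := by linarith [hp.2]
  norm_cast
  rw [← Complex.ofReal_cpow hp.1.le, ← Complex.ofReal_cpow hp', ← Complex.ofReal_mul]
  simp

open ProbabilityTheory in
lemma setIntegral_rpow_mul_one_sub_rpow {a b : ℝ} (ha : 0 < a) (hb : 0 < b) :
    ∫ p in Set.Ioo (0 : ℝ) 1, p ^ (a - 1) * (1 - p) ^ (b - 1) = beta a b := by
  have h := Complex.betaIntegral_convergent (u := a) (v := b) (by simpa) (by simpa)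
  rw [intervalIntegrable_iff_integrableOn_Ioc_of_le zero_le_one] at h
  rw [beta_eq_betaIntegralReal a b ha hb, Complex.betaIntegral,
    intervalIntegral.integral_of_le zero_le_one, ← integral_Ioc_eq_integral_Ioo,
    ← RCLike.re_to_complex, ← integral_re h]
  refine setIntegral_congr_fun measurableSet_Ioc fun p hp => ?_
  have hp' : 0 ≤ 1 - p := by linarith [hp.2]
  norm_cast
  rw [← Complex.ofReal_cpow hp.1.le, ← Complex.ofReal_cpow hp', ← Complex.ofReal_mul]
  simp

open ProbabilityTheory in
lemma beta_add_one_left {a b : ℝ} (ha : 0 < a) (hb : 0 < b) :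
    beta (a + 1) b = a / (a + b) * beta a b := by
  have hab : 0 < a + b := add_pos ha hb
  have hG := (Gamma_pos_of_pos hab).ne'
  rw [beta, beta, add_right_comm, Gamma_add_one ha.ne', Gamma_add_one hab.ne']
  field_simp

open ProbabilityTheory in
/-- Second moment of a Beta distribution about an arbitrary point `e`. -/
lemma setIntegral_sub_sq_mul_rpow_mul_one_sub_rpow {a b : ℝ} (ha : 0 < a) (hb : 0 < b) (e : ℝ) :
    ∫ p in Set.Ioo (0 : ℝ) 1, (p - e) ^ 2 * (p ^ (a - 1) * (1 - p) ^ (b - 1)) =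
      (a * b / ((a + b) ^ 2 * (a + b + 1)) + (a / (a + b) - e) ^ 2) * beta a b := by
  have ha1 : 0 < a + 1 := by linarith
  have ha2 : 0 < a + 1 + 1 := by linarith
  have i0 := integrableOn_rpow_mul_one_sub_rpow ha hb
  have i1 := integrableOn_rpow_mul_one_sub_rpow ha1 hb
  have i2 := integrableOn_rpow_mul_one_sub_rpow ha2 hb
  have expand : ∀ p ∈ Set.Ioo (0 : ℝ) 1, (p - e) ^ 2 * (p ^ (a - 1) * (1 - p) ^ (b - 1)) =
      p ^ (a + 1 + 1 - 1) * (1 - p) ^ (b - 1) - 2 * e * (p ^ (a + 1 - 1) * (1 - p) ^ (b - 1)) +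
        e ^ 2 * (p ^ (a - 1) * (1 - p) ^ (b - 1)) := by
    intro p hp
    have h1 : p ^ (a + 1 - 1) = p ^ (a - 1) * p := by
      rw [← rpow_add_one hp.1.ne']; ring_nf
    have h2 : p ^ (a + 1 + 1 - 1) = p ^ (a - 1) * p * p := by
      rw [← h1, ← rpow_add_one hp.1.ne']; ring_nf
    rw [h1, h2]
    ring
  rw [setIntegral_congr_fun measurableSet_Ioo expand,
    integral_add (by exact i2.sub (i1.const_mul _)) (i0.const_mul _),
    integral_sub i2 (i1.const_mul _),
    integral_const_mul, integral_const_mul, setIntegral_rpow_mul_one_sub_rpow ha hb,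
    setIntegral_rpow_mul_one_sub_rpow ha1 hb, setIntegral_rpow_mul_one_sub_rpow ha2 hb,
    beta_add_one_left ha1 hb, beta_add_one_left ha hb]
  have hab : a + b ≠ 0 := by positivity
  have hab1 : a + b + 1 ≠ 0 := by positivity
  have hab1' : a + 1 + b ≠ 0 := by positivity
  field_simp
  ring

open ProbabilityTheory in
/-- The weighted posterior density is the Beta density with parameters `⌊αn⌋ + γn + 1` and
`2n - ⌊αn⌋ + 1 - γn`. -/
lemma phi3_mul_betaDensity {α γ : ℝ} {n : ℕ} (hx : ⌊α * n⌋₊ ≤ n) {p : ℝ}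
    (hp : p ∈ Set.Ioo (0 : ℝ) 1) :
    phi3 α γ n p * betaDensity n ⌊α * n⌋₊ p =
      (beta (⌊α * n⌋₊ + γ * n + 1) (2 * n - ⌊α * n⌋₊ + 1 - γ * n))⁻¹ *
        (p ^ ((⌊α * n⌋₊ : ℝ) + γ * n + 1 - 1) *
          (1 - p) ^ (2 * (n : ℝ) - ⌊α * n⌋₊ + 1 - γ * n - 1)) := by
  have hp1 : 0 < 1 - p := by linarith [hp.2]
  rw [phi3, kappa3, betaDensity, if_pos ⟨hp.1.le, hp.2.le⟩, beta]
  generalize ⌊α * n⌋₊ = x at *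
  have e1 : p ^ ((x : ℝ) + γ * n + 1 - 1) = p ^ (γ * (n : ℝ)) * p ^ x := by
    rw [← rpow_add_natCast hp.1.ne']; ring_nf
  have e2 : (1 - p) ^ (2 * (n : ℝ) - x + 1 - γ * n - 1) =
      (1 - p) ^ ((1 - γ) * (n : ℝ)) * (1 - p) ^ (n - x) := by
    rw [← rpow_add_natCast hp1.ne', Nat.cast_sub hx]; ring_nf
  have e3 : (x : ℝ) + γ * n + 1 + (2 * n - x + 1 - γ * n) = 2 * n + 2 := by ring
  have g1 : Gamma ((n : ℝ) + 2) = (n + 1) * n.factorial := by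
    rw [← Gamma_nat_eq_factorial, ← Gamma_add_one (by positivity)]; ring_nf
  have g2 : Gamma ((n : ℝ) - x + 1) = (n - x).factorial := by
    rw [← Nat.cast_sub hx, Gamma_nat_eq_factorial]
  have hn : (n.factorial : ℝ) ≠ 0 := by positivity
  have hn1 : (n : ℝ) + 1 ≠ 0 := by positivity
  have hxf : (x.factorial : ℝ) ≠ 0 := by positivity
  have hnx : ((n - x).factorial : ℝ) ≠ 0 := by positivity
  rw [e1, e2, e3, g1, g2, Gamma_nat_eq_factorial, Nat.cast_choose ℝ hx, inv_div, inv_div]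
  simp only [div_eq_mul_inv, mul_inv]
  field_simp

lemma weightedVar3_eq {α γ : ℝ} {n : ℕ} (hx : ⌊α * n⌋₊ ≤ n) (ha : 0 < (⌊α * n⌋₊ : ℝ) + γ * n + 1)
    (hb : 0 < 2 * (n : ℝ) - ⌊α * n⌋₊ + 1 - γ * n) :
    weightedVar3 α γ n =
      (⌊α * n⌋₊ + γ * n + 1) * (2 * n - ⌊α * n⌋₊ + 1 - γ * n) /
          ((2 * n + 2) ^ 2 * (2 * n + 2 + 1)) +
        ((⌊α * n⌋₊ + γ * n + 1) / (2 * n + 2) - (⌊α * n⌋₊ + 1) / (n + 2)) ^ 2 := by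
  have hβ := (ProbabilityTheory.beta_pos ha hb).ne'
  have key := setIntegral_sub_sq_mul_rpow_mul_one_sub_rpow ha hb (((⌊α * n⌋₊ : ℝ) + 1) / (n + 2))
  rw [show (⌊α * n⌋₊ : ℝ) + γ * n + 1 + (2 * n - ⌊α * n⌋₊ + 1 - γ * n) = 2 * n + 2 by ring] at key
  rw [← mul_inv_cancel_right₀ hβ (_ + _), ← key, ← integral_mul_const]
  refine setIntegral_congr_fun measurableSet_Ioo fun p hp => ?_
  simp only [mul_assoc ((p - _) ^ 2), phi3_mul_betaDensity hx hp]
  ring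

/-- For `α, γ ∈ (0,1)` and `x = ⌊αn⌋`, there is a constant `C₃(α,γ)` such
that, eventually in `n`, `V^{φ₃}_n ≥ (α-γ)²/4 + C₃(α,γ)/n - C n^{-3/2}`; in particular the
lower bound does not vanish as `n → ∞` when `α ≠ γ`. -/
theorem weighted_variance_bound_phi3
    (α γ : ℝ) (hα : α ∈ Set.Ioo (0 : ℝ) 1) (hγ : γ ∈ Set.Ioo (0 : ℝ) 1) :
    ∃ C₃ : ℝ, ∃ C > (0 : ℝ), ∃ N : ℕ, ∀ n ≥ N,
      weightedVar3 α γ n ≥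
        (α - γ) ^ 2 / 4 + C₃ / n - C * (n : ℝ) ^ (-(3 : ℝ) / 2) := by
  obtain ⟨hα0, hα1⟩ := hα
  obtain ⟨hγ0, hγ1⟩ := hγ
  refine ⟨-3, 1, one_pos, 1, fun n hn => ?_⟩
  have hn0 : (1 : ℝ) ≤ n := by exact_mod_cast hn
  have hfl : (⌊α * n⌋₊ : ℝ) ≤ α * n := Nat.floor_le (by positivity)
  have hfl' : α * n < ⌊α * n⌋₊ + 1 := Nat.lt_floor_add_one _
  have hxn : ⌊α * n⌋₊ ≤ n := by
    have : (⌊α * n⌋₊ : ℝ) ≤ n := by nlinarith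
    exact_mod_cast this
  have hγn : γ * n < n := by nlinarith
  have hxn' : (⌊α * n⌋₊ : ℝ) ≤ n := by exact_mod_cast hxn
  have ha : 0 < (⌊α * n⌋₊ : ℝ) + γ * n + 1 := by positivity
  have hb : 0 < 2 * (n : ℝ) - ⌊α * n⌋₊ + 1 - γ * n := by linarith
  rw [weightedVar3_eq hxn ha hb]
  generalize (⌊α * n⌋₊ : ℝ) = x at *
  have hvar : 0 ≤ (x + γ * n + 1) * (2 * n - x + 1 - γ * n) /
      ((2 * n + 2) ^ 2 * (2 * n + 2 + 1)) := by positivity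
  have hrate : 0 ≤ (n : ℝ) ^ (-(3 : ℝ) / 2) := by positivity
  have hmean : |(x + γ * n + 1) / (2 * n + 2) - (α + γ) / 2| ≤ 1 / n := by
    have : (x + γ * n + 1) / (2 * n + 2) - (α + γ) / 2 =
        (x - α * n + 1 - α - γ) / (2 * n + 2) := by field_simp; ring
    rw [this, abs_div, abs_of_pos (by positivity : 0 < 2 * (n : ℝ) + 2),
      div_le_div_iff₀ (by positivity) (by positivity)]
    have : |x - α * n + 1 - α - γ| ≤ 2 := abs_le.mpr ⟨by linarith, by linarith⟩
    nlinarith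
  have hunweighted : |(x + 1) / (n + 2) - α| ≤ 2 / n := by
    have : (x + 1) / (n + 2) - α = (x + 1 - α * n - 2 * α) / (n + 2) := by field_simp; ring
    rw [this, abs_div, abs_of_pos (by positivity : 0 < (n : ℝ) + 2),
      div_le_div_iff₀ (by positivity) (by positivity)]
    have : |x + 1 - α * n - 2 * α| ≤ 2 := abs_le.mpr ⟨by linarith, by linarith⟩
    nlinarith
  generalize (x + γ * n + 1) / (2 * n + 2) = m at *
  generalize (x + 1) / ((n : ℝ) + 2) = e at *
  have hD : |m - e - (γ - α) / 2| ≤ 3 / n := by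
    have : m - e - (γ - α) / 2 = (m - (α + γ) / 2) - (e - α) := by ring
    rw [this]
    refine (abs_sub _ _).trans ((add_le_add hmean hunweighted).trans_eq ?_)
    ring
  have hprod : -|m - e - (γ - α) / 2| ≤ (γ - α) * (m - e - (γ - α) / 2) := by
    have h1 : |γ - α| ≤ 1 := abs_le.mpr ⟨by linarith, by linarith⟩
    have h2 := neg_abs_le ((γ - α) * (m - e - (γ - α) / 2))
    rw [abs_mul] at h2
    have h3 := mul_le_of_le_one_left (abs_nonneg (m - e - (γ - α) / 2)) h1
    linarith
  rw [neg_div]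
  nlinarith [sq_nonneg (m - e - (γ - α) / 2)]
end
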